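/- Let H be a finite bipartite simple graph of order at least 4 all of whose connected components are cactus graphs. Then |V(H)| = (3/4)|E(H)| + 1 (i.e., 4|V(H)| = 3|E(H)| + 4) if and only if H is connected and every block of H is a cycle of order 4. -/

import Mathlib

open SimpleGraph

/-- A connected graph is a cactus if no edge is shared by two different cycles,
i.e. any two cycles having a common edge have the same edge set. -/
def isCactus {α : Type*} (K : SimpleGraph α) : Prop :=
  K.Connected ∧ ∀ ⦃u v : α⦄ (c₁ : K.Walk u u) (c₂ : K.Walk v v),
    c₁.IsCycle → c₂.IsCycle → ∀ e, e ∈ c₁.edges → e ∈ c₂.edges →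
      ∀ e', e' ∈ c₁.edges ↔ e' ∈ c₂.edges

/-- Every connected component of `H` is a cactus. -/
def allComponentsCactus {α : Type*} (H : SimpleGraph α) : Prop :=
  ∀ c : H.ConnectedComponent, isCactus (H.induce c.supp)

/-- `H` is bipartite: the vertices can be partitioned into two sets with no edge inside either. -/
def isBipartite {α : Type*} (H : SimpleGraph α) : Prop :=
  ∃ A : Set α, ∀ ⦃u v : α⦄, H.Adj u v → (u ∈ A ↔ v ∉ A)

/-- A subgraph has no cut vertex: removing any single vertex (when it has at
least two vertices) leaves it connected. -/
def hasNoCutVertex {α : Type*} {G : SimpleGraph α} (B : G.Subgraph) : Prop :=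
  ∀ v ∈ B.verts, 2 ≤ B.verts.ncard → ((B.deleteVerts {v}).coe).Connected

/-- A block of : a maximal connected subgraph with no cut vertex. -/
def isBlock {α : Type*} {G : SimpleGraph α} (B : G.Subgraph) : Prop :=
  B.verts.Nonempty ∧ B.coe.Connected ∧ hasNoCutVertex B ∧
    ∀ B' : G.Subgraph, B ≤ B' → B'.coe.Connected → hasNoCutVertex B' → B' = B


def CP {V : Type*} (H : SimpleGraph V) : Prop :=
  ∀ ⦃u v : V⦄ (c₁ : H.Walk u u) (c₂ : H.Walk v v),
    c₁.IsCycle → c₂.IsCycle → ∀ e, e ∈ c₁.edges → e ∈ c₂.edges →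
      ∀ e', e' ∈ c₁.edges ↔ e' ∈ c₂.edges

lemma cp_of_all {V : Type*} (H : SimpleGraph V) (h : allComponentsCactus H) : CP H := by
  intro u v c₁ c₂ h₁ h₂ e he₁ he₂ e'
  set C := H.connectedComponentMk u with hC
  obtain ⟨x, y⟩ := e
  have hx1 : x ∈ c₁.support := c₁.fst_mem_support_of_mem_edges he₁
  have hx2 : x ∈ c₂.support := c₂.fst_mem_support_of_mem_edges he₂
  classical
  have s1 : ∀ z ∈ c₁.support, z ∈ C.supp := by
    intro z hz
    rw [SimpleGraph.ConnectedComponent.mem_supp_iff, hC, SimpleGraph.ConnectedComponent.eq]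
    exact (c₁.takeUntil z hz).reachable.symm
  have s2 : ∀ z ∈ c₂.support, z ∈ C.supp := by
    intro z hz
    rw [SimpleGraph.ConnectedComponent.mem_supp_iff, hC, SimpleGraph.ConnectedComponent.eq]
    exact (c₂.takeUntil z hz).reachable.symm.trans
      ((c₂.takeUntil x hx2).reachable.trans (c₁.takeUntil x hx1).reachable.symm)
  have e1 := SimpleGraph.Walk.map_induce c₁ s1
  have e2 := SimpleGraph.Walk.map_induce c₂ s2
  set d₁ := c₁.induce C.supp s1
  set d₂ := c₂.induce C.supp s2
  have inj : Function.Injective (SimpleGraph.Embedding.induce (G := H) C.supp).toHom :=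
    (SimpleGraph.Embedding.induce (G := H) C.supp).injective
  have k1 : d₁.IsCycle := by
    rw [← SimpleGraph.Walk.isCycle_map_iff_of_injective inj, e1]; exact h₁
  have k2 : d₂.IsCycle := by
    rw [← SimpleGraph.Walk.isCycle_map_iff_of_injective inj, e2]; exact h₂
  have m1 : c₁.edges = d₁.edges.map (Sym2.map (SimpleGraph.Embedding.induce (G := H) C.supp).toHom) := by
    have := congrArg SimpleGraph.Walk.edges e1
    exact this.symm.trans (SimpleGraph.Walk.edges_map _ _)
  have m2 : c₂.edges = d₂.edges.map (Sym2.map (SimpleGraph.Embedding.induce (G := H) C.supp).toHom) := by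
    have := congrArg SimpleGraph.Walk.edges e2
    exact this.symm.trans (SimpleGraph.Walk.edges_map _ _)
  rw [m1, List.mem_map] at he₁
  rw [m2, List.mem_map] at he₂
  obtain ⟨f, hf, hfe⟩ := he₁
  obtain ⟨g, hg, hge⟩ := he₂
  have : f = g := Sym2.map.injective inj (hfe.trans hge.symm)
  subst this
  have key := (h C).2 d₁ d₂ k1 k2 f hf hg
  rw [m1, m2, List.mem_map, List.mem_map]
  simp only [key]

lemma four_le {V : Type*} (H : SimpleGraph V) (hb : isBipartite H) {u : V} (c : H.Walk u u)
    (hc : c.IsCycle) : 4 ≤ c.length := by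
  classical
  obtain ⟨A, hA⟩ := hb
  let col : H.Coloring Bool := SimpleGraph.Coloring.mk (fun v => decide (v ∈ A)) (by
    intro v w hvw
    have := hA hvw
    by_cases h1 : v ∈ A <;> by_cases h2 : w ∈ A <;> simp_all)
  have h1 := (col.even_length_iff_congr c).2 Iff.rfl
  have := hc.three_le_length
  obtain ⟨k, hk⟩ := h1
  omega

lemma forest_card {V : Type*} [Fintype V] [Nonempty V] (F : SimpleGraph V) (hF : F.IsAcyclic) :
    F.edgeSet.ncard + 1 ≤ Fintype.card V ∧
      (F.edgeSet.ncard + 1 = Fintype.card V → F.Connected) := by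
  obtain ⟨T, hFT, -, hT⟩ :=
    (SimpleGraph.connected_top (V := V)).exists_isTree_le_of_le_of_isAcyclic le_top hF
  have h1 := (SimpleGraph.isTree_iff_connected_and_card.1 hT).2
  rw [Nat.card_coe_set_eq, Nat.card_eq_fintype_card] at h1
  have hsub := SimpleGraph.edgeSet_mono hFT
  have h2 := Set.ncard_le_ncard hsub (Set.toFinite _)
  refine ⟨by omega, fun h => ?_⟩
  have := Set.eq_of_subset_of_ncard_le hsub (by omega) (Set.toFinite _)
  have : F = T := SimpleGraph.edgeSet_injective this
  rw [this]; exact hT.connected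

lemma tree_card {V : Type*} [Fintype V] (F : SimpleGraph V) (hF : F.IsAcyclic)
    (hc : F.Connected) : F.edgeSet.ncard + 1 = Fintype.card V := by
  have h1 := (SimpleGraph.isTree_iff_connected_and_card.1 ⟨hc, hF⟩).2
  rwa [Nat.card_coe_set_eq, Nat.card_eq_fintype_card] at h1

lemma fund {V : Type*} (H F : SimpleGraph V) (hFH : F ≤ H) (hr : F.Reachable = H.Reachable)
    (e : Sym2 V) (he : e ∈ H.edgeSet) (heF : e ∉ F.edgeSet) :
    ∃ (u : V) (c : H.Walk u u), c.IsCycle ∧ e ∈ c.edges ∧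
      ∀ f ∈ c.edges, f ∈ F.edgeSet ∨ f = e := by
  obtain ⟨x, y⟩ := e
  change s(x, y) ∈ _ at he
  change s(x, y) ∉ _ at heF
  rw [SimpleGraph.mem_edgeSet] at he heF
  have hle : F ⊔ SimpleGraph.edge x y ≤ H := by
    refine sup_le hFH ?_
    rw [SimpleGraph.edge_le_iff]
    exact Or.inr he
  have hreach : F.Reachable x y := by rw [hr]; exact he.reachable
  have hadj : (F ⊔ SimpleGraph.edge x y).Adj x y := by
    right
    simp [SimpleGraph.edge_adj, he.ne]
  obtain ⟨u, p, hp, hpe⟩ := SimpleGraph.adj_and_reachable_delete_edges_iff_exists_cycle.1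
    ⟨hadj, hreach.mono (by
      intro a b hab
      rw [SimpleGraph.deleteEdges_adj]
      refine ⟨Or.inl hab, ?_⟩
      intro h
      rw [Set.mem_singleton_iff] at h
      apply heF
      rw [← SimpleGraph.mem_edgeSet, ← h]
      exact hab)⟩
  refine ⟨u, p.mapLe hle, hp.mapLe hle, by simpa using hpe, ?_⟩
  intro f hf
  have hf' : f ∈ p.edges := by simpa using hf
  have := p.edges_subset_edgeSet hf'
  rw [SimpleGraph.edgeSet_sup] at this
  rcases this with h | h
  · exact Or.inl h
  · right
    have := SimpleGraph.edgeSet_mono (le_refl (SimpleGraph.edge x y)) h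
    rw [SimpleGraph.edgeSet_edge_of_ne he.ne] at this
    exact this

lemma lemA {V : Type*} [Fintype V] [Nonempty V] (H : SimpleGraph V) (hb : isBipartite H)
    (hcp : CP H) :
    4 * Fintype.card V = 3 * H.edgeSet.ncard + 4 ↔
      (H.Connected ∧ ∀ e ∈ H.edgeSet, ∃ (u : V) (c : H.Walk u u), c.IsCycle ∧ c.length = 4 ∧
        e ∈ c.edges) := by
  classical
  obtain ⟨F, hFH, hF, hr⟩ := H.exists_isAcyclic_reachable_eq_le
  have hconn : F.Connected ↔ H.Connected := by
    rw [SimpleGraph.connected_iff, SimpleGraph.connected_iff,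
      SimpleGraph.preconnected_iff_reachable_eq_top, SimpleGraph.preconnected_iff_reachable_eq_top,
      hr]
  have hfd := fund H F hFH hr
  choose! root cyc hcyc hmem hfun using hfd
  let S : Finset (Sym2 V) := H.edgeFinset \ F.edgeFinset
  let C : Sym2 V → Finset (Sym2 V) := fun e => (cyc e).edges.toFinset
  have hS : ∀ e ∈ S, e ∈ H.edgeSet ∧ e ∉ F.edgeSet := by
    intro e he
    simpa [S] using he
  have hCcard : ∀ e ∈ S, (C e).card = (cyc e).length := by
    intro e he
    have h := hS e he
    rw [← SimpleGraph.Walk.length_edges]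
    exact List.toFinset_card_of_nodup (hcyc e h.1 h.2).isTrail.edges_nodup
  have hC4 : ∀ e ∈ S, 4 ≤ (C e).card := by
    intro e he
    have h := hS e he
    rw [hCcard e he]
    exact four_le H hb _ (hcyc e h.1 h.2)
  have hdis : (S : Set (Sym2 V)).PairwiseDisjoint C := by
    intro e he f hf hne
    have h := hS e he
    have h' := hS f hf
    rw [Function.onFun, Finset.disjoint_left]
    intro g hg hg'
    simp only [C, List.mem_toFinset] at hg hg'
    have := (hcp (cyc e) (cyc f) (hcyc e h.1 h.2) (hcyc f h'.1 h'.2) g hg hg' e).1 (hmem e h.1 h.2)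
    rcases hfun f h'.1 h'.2 e this with h1 | h1
    · exact h.2 h1
    · exact hne h1
  have hU : S.biUnion C ⊆ H.edgeFinset := by
    intro g hg
    simp only [Finset.mem_biUnion, C, List.mem_toFinset] at hg
    obtain ⟨e, -, hg⟩ := hg
    simpa using (cyc e).edges_subset_edgeSet hg
  have hUc : (S.biUnion C).card = ∑ e ∈ S, (C e).card := Finset.card_biUnion hdis
  have hUle := Finset.card_le_card hU
  have hm : H.edgeSet.ncard = H.edgeFinset.card := by
    rw [← SimpleGraph.coe_edgeFinset, Set.ncard_coe_finset]
  have hmF : F.edgeSet.ncard = F.edgeFinset.card := by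
    rw [← SimpleGraph.coe_edgeFinset, Set.ncard_coe_finset]
  have hSc : S.card + F.edgeFinset.card = H.edgeFinset.card :=
    Finset.card_sdiff_add_card_eq_card (SimpleGraph.edgeFinset_mono hFH)
  have hsum : 4 * S.card ≤ ∑ e ∈ S, (C e).card := by
    have := Finset.card_nsmul_le_sum S (fun e => (C e).card) 4 hC4
    simpa [mul_comm] using this
  obtain ⟨hf1, hf2⟩ := forest_card F hF
  rw [hm]
  rw [hmF] at hf1 hf2
  constructor
  · intro heq
    refine ⟨hconn.1 (hf2 (by omega)), ?_⟩
    have hUeq : S.biUnion C = H.edgeFinset := Finset.eq_of_subset_of_card_le hU (by omega)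
    have hsum' : ∑ e ∈ S, 4 = ∑ e ∈ S, (C e).card := by
      rw [Finset.sum_const, smul_eq_mul]; omega
    have hall := (Finset.sum_eq_sum_iff_of_le hC4).1 hsum'
    intro g hg
    have : g ∈ S.biUnion C := by rw [hUeq]; simpa using hg
    simp only [Finset.mem_biUnion] at this
    obtain ⟨e, he, hge⟩ := this
    have h := hS e he
    exact ⟨_, cyc e, hcyc e h.1 h.2, by rw [← hCcard e he, ← hall e he], by simpa [C] using hge⟩
  · rintro ⟨hc, hall⟩
    have htc := tree_card F hF (hconn.2 hc)
    rw [hmF] at htc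
    have hUeq : S.biUnion C = H.edgeFinset := by
      apply Finset.Subset.antisymm hU
      intro g hg
      obtain ⟨u, c, hcc, -, hgc⟩ := hall g (by simpa using hg)
      have : ∃ e ∈ c.edges, e ∉ F.edgeSet := by
        by_contra hcon
        push Not at hcon
        exact hF _ (hcc.transfer hcon)
      obtain ⟨e, hec, heF⟩ := this
      have heH := c.edges_subset_edgeSet hec
      simp only [Finset.mem_biUnion]
      refine ⟨e, by simp [S, heF, heH], ?_⟩
      simp only [C, List.mem_toFinset]
      exact (hcp c (cyc e) hcc (hcyc e heH heF) e hec (hmem e heH heF) g).1 hgc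
    have h4 : ∀ e ∈ S, (C e).card = 4 := by
      intro e he
      have h := hS e he
      obtain ⟨u, c, hcc, hcl, hec⟩ := hall e h.1
      have : C e = c.edges.toFinset := by
        ext g
        simp only [C, List.mem_toFinset]
        exact hcp (cyc e) c (hcyc e h.1 h.2) hcc e (hmem e h.1 h.2) hec g
      rw [this, List.toFinset_card_of_nodup hcc.isTrail.edges_nodup,
        SimpleGraph.Walk.length_edges, hcl]
    rw [hUeq, Finset.sum_congr rfl h4, Finset.sum_const, smul_eq_mul] at hUc
    omega

structure C4 {V : Type*} (H : SimpleGraph V) (a b c d : V) : Prop where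
  ab : H.Adj a b
  bc : H.Adj b c
  cd : H.Adj c d
  da : H.Adj d a
  ac : a ≠ c
  bd : b ≠ d

lemma C4.rot {V : Type*} {H : SimpleGraph V} {a b c d : V} (h : C4 H a b c d) : C4 H b c d a :=
  ⟨h.bc, h.cd, h.da, h.ab, h.bd, h.ac.symm⟩

def C4.walk {V : Type*} {H : SimpleGraph V} {a b c d : V} (h : C4 H a b c d) : H.Walk a a :=
  .cons h.ab (.cons h.bc (.cons h.cd (.cons h.da .nil)))

def D4 {V : Type*} (a b c d : V) : Set (Sym2 V) := {s(a,b), s(b,c), s(c,d), s(d,a)}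

lemma D4_rot {V : Type*} (a b c d : V) : D4 b c d a = D4 a b c d := by
  ext e; simp only [D4, Set.mem_insert_iff, Set.mem_singleton_iff]; tauto

lemma C4.mem_edges {V : Type*} {H : SimpleGraph V} {a b c d : V} (h : C4 H a b c d) (e : Sym2 V) :
    e ∈ h.walk.edges ↔ e ∈ D4 a b c d := by
  simp [C4.walk, D4]

lemma C4.isCycle {V : Type*} {H : SimpleGraph V} {a b c d : V} (h : C4 H a b c d) :
    h.walk.IsCycle := by
  have h1 := h.ab.ne
  have h2 := h.bc.ne
  have h3 := h.cd.ne
  have h4 := h.da.ne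
  have h5 := h.ac
  have h6 := h.bd
  simp only [C4.walk, SimpleGraph.Walk.cons_isCycle_iff, SimpleGraph.Walk.cons_isPath_iff]
  simp
  grind

lemma C4.of_cycle {V : Type*} {H : SimpleGraph V} {u : V} (c : H.Walk u u) (hc : c.IsCycle)
    (hl : c.length = 4) : ∃ x y z, ∃ h : C4 H u x y z, c = h.walk := by
  match c, hc, hl with
  | .cons h1 (.cons h2 (.cons h3 (.cons h4 .nil))), hc, _ =>
    simp only [SimpleGraph.Walk.cons_isCycle_iff, SimpleGraph.Walk.cons_isPath_iff] at hc
    simp at hc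
    refine ⟨_, _, _, ⟨h1, h2, h3, h4, ?_, ?_⟩, rfl⟩ <;> grind

lemma C4.core {V : Type*} {H : SimpleGraph V} (hcp : CP H) {a b c d : V} (h : C4 H a b c d)
    {x y : V} {g : Sym2 V} (he : s(x, y) ∈ D4 a b c d) (hg : g ∈ D4 a b c d) (hne : s(x, y) ≠ g)
    (hr : ((H.deleteEdges {g}).deleteEdges {s(x, y)}).Reachable x y) : False := by
  have heH : H.Adj x y := by
    rw [← h.mem_edges] at he
    exact h.walk.edges_subset_edgeSet he
  have hadj : (H.deleteEdges {g}).Adj x y := by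
    rw [SimpleGraph.deleteEdges_adj]; exact ⟨heH, hne⟩
  obtain ⟨u, p, hp, hpe⟩ := SimpleGraph.adj_and_reachable_delete_edges_iff_exists_cycle.1
    ⟨hadj, hr⟩
  have hle := SimpleGraph.deleteEdges_le (G := H) {g}
  have := (hcp h.walk (p.mapLe hle) h.isCycle (hp.mapLe hle) s(x, y) ((h.mem_edges _).2 he)
    (by simpa using hpe) g).1 ((h.mem_edges _).2 hg)
  have hgp : g ∈ p.edges := by simpa using this
  have := p.edges_subset_edgeSet hgp
  rw [SimpleGraph.edgeSet_deleteEdges] at this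
  exact this.2 rfl

lemma C4.nr1 {V : Type*} {H : SimpleGraph V} (hcp : CP H) {a b c d : V} (h : C4 H a b c d) :
    ¬ (H.deleteEdges (D4 a b c d)).Reachable a b := by
  intro hr
  have h5 := h.ac
  have := h.ab.ne
  refine h.core hcp (x := a) (y := b) (g := s(b, c)) (by simp [D4]) (by simp [D4])
    (by simp; grind) (hr.mono ?_)
  intro x y hxy
  simp only [SimpleGraph.deleteEdges_adj, D4, Set.mem_insert_iff, Set.mem_singleton_iff] at hxy ⊢
  tauto

lemma C4.nr2 {V : Type*} {H : SimpleGraph V} (hcp : CP H) {a b c d : V} (h : C4 H a b c d) :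
    ¬ (H.deleteEdges (D4 a b c d)).Reachable a c := by
  intro hr
  have h5 := h.ac
  have h6 := h.bd
  have h7 := h.ab.ne
  have h8 := h.bc.ne
  refine h.core hcp (x := a) (y := b) (g := s(c, d)) (by simp [D4]) (by simp [D4])
    (by simp; grind) ((hr.mono ?_).trans (SimpleGraph.Adj.reachable (v := b) ?_))
  · intro x y hxy
    simp only [SimpleGraph.deleteEdges_adj, D4, Set.mem_insert_iff, Set.mem_singleton_iff] at hxy ⊢
    tauto
  · simp only [SimpleGraph.deleteEdges_adj, Set.mem_singleton_iff]
    refine ⟨⟨h.bc.symm, ?_⟩, ?_⟩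
    · simp; grind
    · simp; grind

lemma C4.nr {V : Type*} {H : SimpleGraph V} (hcp : CP H) {a b c d : V} (h : C4 H a b c d)
    {x y : V} (hx : x ∈ ({a, b, c, d} : Set V)) (hy : y ∈ ({a, b, c, d} : Set V))
    (hr : (H.deleteEdges (D4 a b c d)).Reachable x y) : x = y := by
  have r1 := h.nr1 hcp
  have r2 := h.nr2 hcp
  have r3 := h.rot.nr1 hcp
  have r4 := h.rot.nr2 hcp
  have r5 := h.rot.rot.nr1 hcp
  have r6 := h.rot.rot.rot.nr1 hcp
  simp only [D4_rot] at r3 r4 r5 r6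
  simp only [Set.mem_insert_iff, Set.mem_singleton_iff] at hx hy
  have hr' := hr.symm
  rcases hx with rfl | rfl | rfl | rfl <;> rcases hy with rfl | rfl | rfl | rfl <;>
    first | rfl | exact absurd hr ‹_› | exact absurd hr' ‹_›

lemma reach_hit {V : Type*} {H : SimpleGraph V} {a b c d : V} (B : H.Subgraph)
    {y w : B.verts} (p : B.coe.Walk y w) (hw : (w : V) ∈ ({a, b, c, d} : Set V)) :
    ∃ x ∈ ({a, b, c, d} : Set V), x ∈ B.verts ∧
      (H.deleteEdges (D4 a b c d)).Reachable (y : V) x := by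
  induction p with
  | nil => exact ⟨_, hw, Subtype.property _, .rfl⟩
  | @cons u v w hadj p ih =>
    obtain ⟨x, hx, hxB, hr⟩ := ih hw
    by_cases hu : (u : V) ∈ ({a, b, c, d} : Set V)
    · exact ⟨_, hu, u.2, .rfl⟩
    · refine ⟨x, hx, hxB, SimpleGraph.Reachable.trans (SimpleGraph.Adj.reachable ?_) hr⟩
      rw [SimpleGraph.deleteEdges_adj]
      refine ⟨B.adj_sub hadj, ?_⟩
      simp only [D4, Set.mem_insert_iff, Set.mem_singleton_iff] at hu ⊢
      simp only [Sym2.eq_iff]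
      tauto

lemma C4.block_le {V : Type*} [Fintype V] {H : SimpleGraph V} (hcp : CP H) {a b c d : V}
    (h : C4 H a b c d) (B : H.Subgraph) (hB : B.coe.Connected) (hcut : hasNoCutVertex B)
    {u v : V} (huv : B.Adj u v) (hu : u ∈ ({a, b, c, d} : Set V))
    (hv : v ∈ ({a, b, c, d} : Set V)) : B ≤ h.walk.toSubgraph := by
  have hverts : ∀ y ∈ B.verts, y ∈ ({a, b, c, d} : Set V) := by
    intro y hy
    obtain ⟨p⟩ := hB.preconnected ⟨y, hy⟩ ⟨u, huv.fst_mem⟩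
    obtain ⟨x, hx, hxB, hr⟩ := reach_hit B p hu
    by_cases hyx : y = x
    · rw [hyx]; exact hx
    exfalso
    have hc2 : 2 ≤ B.verts.ncard := by
      have : Set.ncard ({u, v} : Set V) ≤ B.verts.ncard := by
        apply Set.ncard_le_ncard _ (Set.toFinite _)
        intro z hz
        rcases hz with rfl | rfl
        · exact huv.fst_mem
        · exact huv.snd_mem
      rwa [Set.ncard_pair huv.ne] at this
    have hdel := hcut x hxB hc2
    obtain ⟨w, hw, hwB, hwx⟩ : ∃ w ∈ ({a, b, c, d} : Set V), w ∈ B.verts ∧ w ≠ x := by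
      by_cases hux : u = x
      · exact ⟨v, hv, huv.snd_mem, fun h => huv.ne (hux.trans h.symm)⟩
      · exact ⟨u, hu, huv.fst_mem, hux⟩
    obtain ⟨q⟩ := hdel.preconnected ⟨y, by simp [hy, hyx]⟩ ⟨w, by simp [hwB, hwx]⟩
    obtain ⟨x', hx', hx'B, hr'⟩ := reach_hit _ q hw
    have := h.nr hcp hx hx' (hr.symm.trans hr')
    simp at hx'B
    exact hx'B.2 this.symm
  constructor
  · intro y hy
    have := hverts y hy
    rw [SimpleGraph.Walk.mem_verts_toSubgraph]
    simp [C4.walk] at this ⊢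
    tauto
  · intro x y hxy
    have hx := hverts x hxy.fst_mem
    have hy := hverts y hxy.snd_mem
    rw [SimpleGraph.Walk.adj_toSubgraph_iff_mem_edges, h.mem_edges]
    by_contra hcon
    refine hxy.ne (h.nr hcp hx hy (SimpleGraph.Adj.reachable ?_))
    rw [SimpleGraph.deleteEdges_adj]
    exact ⟨hxy.adj_sub, hcon⟩

lemma C4.sub_rot {V : Type*} {H : SimpleGraph V} {a b c d : V} (h : C4 H a b c d) :
    h.rot.walk.toSubgraph = h.walk.toSubgraph := by
  ext x y
  · simp only [SimpleGraph.Walk.mem_verts_toSubgraph, C4.walk]; simp; tauto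
  · simp only [SimpleGraph.Walk.adj_toSubgraph_iff_mem_edges, C4.mem_edges, D4_rot]

lemma C4.del {V : Type*} {H : SimpleGraph V} {a b c d : V} (h : C4 H a b c d) :
    ((h.walk.toSubgraph.deleteVerts {a}).coe).Connected := by
  have h1 := h.ab.ne
  have h4 := h.da.ne
  have h5 := h.ac
  have hc := (SimpleGraph.Walk.cons h.bc (.cons h.cd .nil)).toSubgraph_connected
  refine (SimpleGraph.Subgraph.Connected.mono ?_ ?_ hc).coe
  · constructor
    · intro x
      simp [C4.walk]
      grind
    · intro x y
      rw [SimpleGraph.Subgraph.deleteVerts_adj]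
      simp only [SimpleGraph.Walk.adj_toSubgraph_iff_mem_edges, C4.mem_edges,
        SimpleGraph.Walk.mem_verts_toSubgraph]
      simp [C4.walk, D4]
      grind
  · ext x
    simp [C4.walk]
    grind

lemma C4.noCut {V : Type*} {H : SimpleGraph V} {a b c d : V} (h : C4 H a b c d) :
    hasNoCutVertex h.walk.toSubgraph := by
  intro v hv _
  rw [SimpleGraph.Walk.mem_verts_toSubgraph] at hv
  simp [C4.walk] at hv
  have k1 := h.del
  have k2 := h.rot.del
  have k3 := h.rot.rot.del
  have k4 := h.rot.rot.rot.del
  rw [h.sub_rot] at k2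
  rw [h.rot.sub_rot, h.sub_rot] at k3
  rw [h.rot.rot.sub_rot, h.rot.sub_rot, h.sub_rot] at k4
  rcases hv with rfl | rfl | rfl | rfl | rfl <;> assumption

lemma edge_noCut {V : Type*} {H : SimpleGraph V} {u v : V} (h : H.Adj u v) :
    hasNoCutVertex (H.subgraphOfAdj h) := by
  intro x hx _
  have key : ∀ z, ∀ B : H.Subgraph, B.verts = {z} → B.coe.Connected := by
    intro z B hB
    have : Nonempty B.verts := ⟨⟨z, by rw [hB]; rfl⟩⟩
    have : Subsingleton B.verts := by rw [hB]; infer_instance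
    exact SimpleGraph.Connected.of_subsingleton
  have hne := h.ne
  simp at hx
  rcases hx with rfl | rfl
  · exact key v _ (by ext; simp; grind)
  · exact key u _ (by ext; simp; grind)

lemma lemB {V : Type*} [Fintype V] (H : SimpleGraph V) (hn : 4 ≤ Fintype.card V)
    (hcp : CP H) (hH : H.Connected) :
    (∀ e ∈ H.edgeSet, ∃ (u : V) (c : H.Walk u u), c.IsCycle ∧ c.length = 4 ∧ e ∈ c.edges) ↔
    ∀ B : H.Subgraph, isBlock B →
        ∃ (u : V) (c : H.Walk u u), c.IsCycle ∧ c.length = 4 ∧ c.toSubgraph = B := by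
  constructor
  · intro hall B ⟨hne, hconn, hcut, hmax⟩
    have hadj : ∃ u v, B.Adj u v := by
      by_contra hcon
      push Not at hcon
      obtain ⟨x, hx⟩ := hne
      have hsub : ∀ y ∈ B.verts, y = x := by
        intro y hy
        obtain ⟨p⟩ := hconn.preconnected ⟨y, hy⟩ ⟨x, hx⟩
        cases p with
        | nil => rfl
        | cons h _ => exact absurd h (hcon _ _)
      have : Nontrivial V := Fintype.one_lt_card_iff_nontrivial.1 (by omega)
      obtain ⟨w, hw⟩ := hH.preconnected.exists_adj_of_nontrivial x
      have := hmax (H.subgraphOfAdj hw) ⟨by intro y hy; simp [hsub y hy],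
        by intro y z hyz; exact absurd hyz (hcon _ _)⟩
        (SimpleGraph.Subgraph.subgraphOfAdj_connected hw).coe (edge_noCut hw)
      apply hcon x w
      rw [← this]
      simp
    obtain ⟨u, v, huv⟩ := hadj
    obtain ⟨r, c, hc, hl, he⟩ := hall s(u, v) huv.adj_sub
    refine ⟨r, c, hc, hl, ?_⟩
    have hu := c.fst_mem_support_of_mem_edges he
    have hv := c.snd_mem_support_of_mem_edges he
    obtain ⟨x, y, z, h4, rfl⟩ := C4.of_cycle c hc hl
    refine hmax _ (h4.block_le hcp B hconn hcut huv ?_ ?_)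
      (h4.walk.toSubgraph_connected).coe h4.noCut
    · simp [C4.walk] at hu ⊢; tauto
    · simp [C4.walk] at hv ⊢; tauto
  · intro hall e he
    induction e with | h u v
    rw [SimpleGraph.mem_edgeSet] at he
    obtain ⟨B, hle, hB⟩ := Set.Finite.exists_le_maximal
      (Set.toFinite {B : H.Subgraph | B.coe.Connected ∧ hasNoCutVertex B})
      (a := H.subgraphOfAdj he)
      ⟨(SimpleGraph.Subgraph.subgraphOfAdj_connected he).coe, edge_noCut he⟩
    have hBadj : B.Adj u v := hle.2 (by simp)
    obtain ⟨r, c, hc, hl, hs⟩ := hall B ⟨⟨u, hBadj.fst_mem⟩, hB.prop.1, hB.prop.2,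
      fun B' h1 h2 h3 => (hB.eq_of_le ⟨h2, h3⟩ h1).symm⟩
    refine ⟨r, c, hc, hl, ?_⟩
    rw [← SimpleGraph.Walk.adj_toSubgraph_iff_mem_edges, hs]
    exact hBadj

theorem stmt15 {V : Type*} [Fintype V] (H : SimpleGraph V)
    (hn : 4 ≤ Fintype.card V) (hbip : isBipartite H)
    (hcac : allComponentsCactus H) :
    4 * Fintype.card V = 3 * H.edgeSet.ncard + 4 ↔
      (H.Connected ∧ ∀ B : H.Subgraph, isBlock B →
        ∃ (u : V) (c : H.Walk u u), c.IsCycle ∧ c.length = 4 ∧ c.toSubgraph = B) := by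
  have : Nonempty V := Fintype.card_pos_iff.1 (by omega)
  have hcp := cp_of_all H hcac
  rw [lemA H hbip hcp]
  exact and_congr_right fun hH => lemB H hn hcp hH
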